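/- Newton iteration for the matrix square root: let A be a symmetric positive definite n×n real matrix, and define the sequence of matrices Ω₀ = A, Ω_{k+1} = (1/2)(Ω_k + Ω_k⁻¹ A). Then every Ω_k is symmetric positive definite (hence invertible) and commutes with A, and the sequence (Ω_k) converges, as k → ∞, to the unique symmetric positive definite matrix Ω satisfying Ω² = A. -/

import Mathlib

open Matrix Filter

/-- Newton's iteration, started at `d`, for the positive square root of `d`. -/
noncomputable def sqrtNewtonSeq (d : ℝ) : ℕ → ℝ
  | 0 => d
  | k + 1 => 2⁻¹ * (sqrtNewtonSeq d k + (sqrtNewtonSeq d k)⁻¹ * d)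

lemma sqrtNewtonSeq_pos {d : ℝ} (hd : 0 < d) (k : ℕ) : 0 < sqrtNewtonSeq d k := by
  induction k with
  | zero => exact hd
  | succ k ih => rw [sqrtNewtonSeq]; positivity

lemma sqrtNewtonSeq_succ_sub_sqrt {d : ℝ} (hd : 0 < d) (k : ℕ) :
    sqrtNewtonSeq d (k + 1) - √d = (sqrtNewtonSeq d k - √d) ^ 2 / (2 * sqrtNewtonSeq d k) := by
  have h := (sqrtNewtonSeq_pos hd k).ne'
  rw [sqrtNewtonSeq]
  field_simp
  linear_combination -Real.sq_sqrt hd.le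

lemma sqrt_le_sqrtNewtonSeq_succ {d : ℝ} (hd : 0 < d) (k : ℕ) :
    √d ≤ sqrtNewtonSeq d (k + 1) := by
  have h := sqrtNewtonSeq_pos hd k
  rw [← sub_nonneg, sqrtNewtonSeq_succ_sub_sqrt hd]
  positivity

lemma sqrtNewtonSeq_succ_sub_sqrt_le {d : ℝ} (hd : 0 < d) (k : ℕ) :
    sqrtNewtonSeq d (k + 1) - √d ≤ (sqrtNewtonSeq d 1 - √d) * (1 / 2) ^ k := by
  induction k with
  | zero => simp
  | succ k ih =>
    have h := sqrtNewtonSeq_pos hd (k + 1)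
    have hle := sqrt_le_sqrtNewtonSeq_succ hd k
    have hhalf : sqrtNewtonSeq d (k + 1 + 1) - √d ≤ (sqrtNewtonSeq d (k + 1) - √d) * (1 / 2) := by
      rw [sqrtNewtonSeq_succ_sub_sqrt hd, div_le_iff₀ (by positivity)]
      nlinarith [mul_nonneg (sub_nonneg.2 hle) (Real.sqrt_nonneg d)]
    rw [pow_succ]
    linarith

lemma tendsto_sqrtNewtonSeq {d : ℝ} (hd : 0 < d) :
    Tendsto (sqrtNewtonSeq d) atTop (nhds √d) := by
  rw [← tendsto_add_atTop_iff_nat 1]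
  have hgeom : Tendsto (fun k : ℕ => √d + (sqrtNewtonSeq d 1 - √d) * (1 / 2) ^ k) atTop
      (nhds √d) := by
    simpa using ((tendsto_pow_atTop_nhds_zero_of_lt_one (r := (1 / 2 : ℝ)) (by norm_num)
      (by norm_num)).const_mul (sqrtNewtonSeq d 1 - √d)).const_add √d
  exact tendsto_of_tendsto_of_tendsto_of_le_of_le tendsto_const_nhds hgeom
    (sqrt_le_sqrtNewtonSeq_succ hd)
    fun k => sub_le_iff_le_add'.1 (sqrtNewtonSeq_succ_sub_sqrt_le hd k)

/-- A real symmetric matrix has at most one positive definite square root. -/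
lemma Matrix.PosDef.eq_of_mul_self_eq {ι : Type*} [Fintype ι] [DecidableEq ι]
    {B C : Matrix ι ι ℝ} (hB : B.PosDef) (hC : C.PosDef) (h : B * B = C * C) : B = C := by
  have hD : (B - C).IsHermitian := hB.isHermitian.sub hC.isHermitian
  rw [← sub_eq_zero, ← hD.eigenvalues_eq_zero_iff]
  funext i
  set v : ι → ℝ := ⇑(hD.eigenvectorBasis i)
  have hv : v ≠ 0 := fun h0 => hD.eigenvectorBasis.orthonormal.ne_zero i
    (by ext j; exact congrFun h0 j)
  have hDv : (B - C) *ᵥ v = hD.eigenvalues i • v := hD.mulVec_eigenvectorBasis i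
  have hvD : v ᵥ* (B - C) = hD.eigenvalues i • v := by
    rw [← hDv, ← mulVec_transpose, ← conjTranspose_eq_transpose_of_trivial, hD.eq]
  have hpos := (hB.add hC).dotProduct_mulVec_pos hv
  have hzero : v ⬝ᵥ ((B * (B - C) + (B - C) * C) *ᵥ v) = 0 := by
    rw [mul_sub, sub_mul, h]; simp
  rw [add_mulVec, ← mulVec_mulVec, ← mulVec_mulVec, hDv, dotProduct_add,
    dotProduct_mulVec v (B - C), hvD, mulVec_smul, dotProduct_smul, smul_dotProduct,
    ← smul_add, ← dotProduct_add, ← add_mulVec, smul_eq_mul] at hzero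
  rw [star_trivial] at hpos
  exact (mul_eq_zero.1 hzero).resolve_right hpos.ne'

/-- **Newton iteration for the matrix square root.** For a
symmetric positive definite `A`, the iteration `Ω₀ = A`,
`Ω_{k+1} = (Ω_k + Ω_k⁻¹ A)/2` consists of symmetric positive definite (hence
invertible) matrices commuting with `A`, and converges to the unique symmetric
positive definite matrix `Ω` with `Ω² = A`. -/
theorem stmt13 (n : ℕ) (A : Matrix (Fin n) (Fin n) ℝ) (hA : A.PosDef)
    (Om : ℕ → Matrix (Fin n) (Fin n) ℝ)
    (hOm0 : Om 0 = A)
    (hOmrec : ∀ k : ℕ, Om (k + 1) = (2:ℝ)⁻¹ • (Om k + (Om k)⁻¹ * A)) :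
    (∀ k : ℕ, (Om k).PosDef ∧ IsUnit (Om k) ∧ Om k * A = A * Om k) ∧
    ∃ Omlim : Matrix (Fin n) (Fin n) ℝ, Omlim.PosDef ∧ Omlim * Omlim = A ∧
      (∀ B : Matrix (Fin n) (Fin n) ℝ, B.PosDef → B * B = A → B = Omlim) ∧
      Tendsto Om atTop (nhds Omlim) := by
  set d := hA.isHermitian.eigenvalues
  have hd : ∀ i, 0 < d i := hA.eigenvalues_pos
  let φ := Unitary.conjStarAlgAut ℝ _ hA.isHermitian.eigenvectorUnitary
  have hφ (M) : φ M = (hA.isHermitian.eigenvectorUnitary : Matrix (Fin n) (Fin n) ℝ) * M *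
      star (hA.isHermitian.eigenvectorUnitary : Matrix (Fin n) (Fin n) ℝ) := rfl
  have hAφ : A = φ (diagonal d) := hA.isHermitian.spectral_theorem
  have hpos {x : Fin n → ℝ} (hx : ∀ i, 0 < x i) : (φ (diagonal x)).PosDef := by
    have hU := (Unitary.toUnits hA.isHermitian.eigenvectorUnitary).isUnit
    exact (Matrix.IsUnit.posDef_star_right_conjugate_iff hU).2 (posDef_diagonal_iff.2 hx)
  have hOm (k : ℕ) : Om k = φ (diagonal fun i => sqrtNewtonSeq (d i) k) := by
    induction k with
    | zero => rw [hOm0]; exact hAφ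
    | succ k ih =>
      have hinv : (Om k)⁻¹ = φ (diagonal fun i => (sqrtNewtonSeq (d i) k)⁻¹) := by
        apply inv_eq_right_inv
        rw [ih, ← map_mul, diagonal_mul_diagonal, ← map_one φ, ← diagonal_one]
        congr 2
        funext i
        exact mul_inv_cancel₀ (sqrtNewtonSeq_pos (hd i) k).ne'
      rw [hOmrec, hinv, ih, hAφ, ← map_mul, ← map_add, ← map_smul, diagonal_mul_diagonal,
        diagonal_add, ← diagonal_smul]
      rfl
  have hOmpos (k : ℕ) : (Om k).PosDef := hOm k ▸ hpos fun i => sqrtNewtonSeq_pos (hd i) k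
  have hsq : φ (diagonal fun i => √(d i)) * φ (diagonal fun i => √(d i)) = A := by
    rw [← map_mul, diagonal_mul_diagonal]
    simp only [Real.mul_self_sqrt (hd _).le]
    exact hAφ.symm
  have hlimpos : (φ (diagonal fun i => √(d i))).PosDef := hpos fun i => Real.sqrt_pos.2 (hd i)
  refine ⟨fun k => ⟨hOmpos k, (hOmpos k).isUnit, ?_⟩, _, hlimpos, hsq,
    fun B hB hBA => hB.eq_of_mul_self_eq hlimpos (hBA.trans hsq.symm), ?_⟩
  · rw [hOm k, hAφ, ← map_mul, ← map_mul, diagonal_mul_diagonal, diagonal_mul_diagonal]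
    simp only [mul_comm]
  · have hcont : Continuous fun x : Fin n → ℝ => φ (diagonal x) := by
      simp only [hφ]
      fun_prop
    rw [funext hOm]
    exact (hcont.tendsto _).comp (tendsto_pi_nhds.2 fun i => tendsto_sqrtNewtonSeq (hd i))
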